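/- Let n ≥ 3 be an integer, let μ be a real number with 0 < μ < n, and let ρ > 0. There exists a constant C > 0 such that for every λ ≥ 1 with λρ ≥ 1, the double integral ∫_{{x ∈ ℝⁿ : ‖x‖ > ρ/2}} ∫_{{y ∈ ℝⁿ : ‖y‖ > ρ/2}} ‖x − y‖^{−μ} · λ^{(2n−μ)/2} (1 + λ²‖y‖²)^{−(2n−μ)/2} · λ^{(2n−μ)/2} (1 + λ²‖x‖²)^{−(2n−μ)/2} dy dx is at most C · λ^{−(2n−μ)}. -/

import Mathlib

open MeasureTheory

/-- Away from the origin, a concentrated bubble power is controlled by the bubble power of unit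
scale. -/
lemma rpow_mul_one_add_sq_rpow_neg_le {ρ lam r a : ℝ} (hρ : 0 < ρ) (hlam : 0 < lam) (ha : 0 ≤ a)
    (hr : ρ / 2 < r) :
    lam ^ a * (1 + lam ^ 2 * r ^ 2) ^ (-a) ≤
      (ρ ^ 2 / (4 + ρ ^ 2)) ^ (-a) * lam ^ (-a) * (1 + r ^ 2) ^ (-a) := by
  set c := ρ ^ 2 / (4 + ρ ^ 2) with hc
  have hcpos : 0 < c := by positivity
  have hcr : c * (1 + r ^ 2) ≤ r ^ 2 := by
    rw [hc, div_mul_eq_mul_div, div_le_iff₀ (by positivity)]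
    nlinarith
  have hbase : lam ^ 2 * (c * (1 + r ^ 2)) ≤ 1 + lam ^ 2 * r ^ 2 := by
    nlinarith [mul_le_mul_of_nonneg_left hcr (sq_nonneg lam)]
  have hlam2 : lam ^ a * (lam ^ 2) ^ (-a) = lam ^ (-a) := by
    rw [← Real.rpow_natCast, ← Real.rpow_mul hlam.le, ← Real.rpow_add hlam]
    congr 1
    push_cast
    ring
  calc lam ^ a * (1 + lam ^ 2 * r ^ 2) ^ (-a)
      ≤ lam ^ a * (lam ^ 2 * (c * (1 + r ^ 2))) ^ (-a) := by
        gcongr ?_ * ?_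
        exact Real.rpow_le_rpow_of_nonpos (by positivity) hbase (by linarith)
    _ = lam ^ a * (lam ^ 2) ^ (-a) * (c ^ (-a) * (1 + r ^ 2) ^ (-a)) := by
        rw [Real.mul_rpow (by positivity) (by positivity),
          Real.mul_rpow (by positivity) (by positivity), mul_assoc]
    _ = _ := by
        rw [hlam2]
        ring

/-- The singularity of a Riesz kernel of order less than the dimension has finite mass. -/
lemma lintegral_ball_norm_rpow_neg_lt_top {E : Type*} [NormedAddCommGroup E] [NormedSpace ℝ E]
    [FiniteDimensional ℝ E] [MeasurableSpace E] [BorelSpace E] (ν : Measure E)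
    [ν.IsAddHaarMeasure] (hd : 1 ≤ Module.finrank ℝ E) {μ : ℝ} (hμ : μ < Module.finrank ℝ E)
    (r : ℝ) :
    ∫⁻ z in Metric.ball (0 : E) r, ENNReal.ofReal (‖z‖ ^ (-μ)) ∂ν < ⊤ := by
  have hint : IntegrableOn (fun z : E ↦ ‖z‖ ^ (-μ)) (Metric.ball 0 r) ν := by
    refine integrableOn_ball_of_norm_le_rpow hd hμ (C := 1) (ae_of_all _ fun z ↦ ?_) ?_
    · rw [one_mul, Real.norm_of_nonneg (by positivity)]
    · exact Measurable.aestronglyMeasurable (by fun_prop)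
  exact hint.lintegral_lt_top

/-- The Riesz kernel splits into its singular part and a part bounded by one. -/
lemma ofReal_div_norm_rpow_le {E : Type*} [NormedAddCommGroup E] {μ t : ℝ} (hμ : 0 ≤ μ)
    (ht1 : t ≤ 1) (z : E) :
    ENNReal.ofReal (t / ‖z‖ ^ μ) ≤ ENNReal.ofReal t +
      (Metric.ball (0 : E) 1).indicator (fun z ↦ ENNReal.ofReal (‖z‖ ^ (-μ))) z := by
  by_cases hz : z ∈ Metric.ball (0 : E) 1
  · rw [Set.indicator_of_mem hz, Real.rpow_neg (norm_nonneg z)]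
    refine le_add_left (ENNReal.ofReal_le_ofReal ?_)
    rw [div_eq_mul_inv]
    exact mul_le_of_le_one_left (by positivity) ht1
  · rw [Set.indicator_of_notMem hz, add_zero]
    rw [mem_ball_zero_iff, not_lt] at hz
    rcases le_total 0 t with ht | ht
    · exact ENNReal.ofReal_le_ofReal (div_le_self ht (Real.one_le_rpow hz hμ))
    · rw [ENNReal.ofReal_of_nonpos (div_nonpos_of_nonpos_of_nonneg ht (by positivity))]
      exact zero_le

/-- The Riesz energy of a function bounded by one is controlled by its integral and the mass of
the singular part of the kernel. -/
lemma lintegral_lintegral_riesz_le {E : Type*} [NormedAddCommGroup E] [MeasurableSpace E]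
    [BorelSpace E] (ν : Measure E) [ν.IsAddLeftInvariant] [ν.IsNegInvariant]
    {μ : ℝ} (hμ : 0 ≤ μ) {g : E → ℝ} (hg : Measurable g)
    (hg1 : ∀ x, g x ≤ 1) :
    ∫⁻ x, ENNReal.ofReal (g x) * ∫⁻ y, ENNReal.ofReal (g y / ‖x - y‖ ^ μ) ∂ν ∂ν ≤
      (∫⁻ x, ENNReal.ofReal (g x) ∂ν) * ((∫⁻ y, ENNReal.ofReal (g y) ∂ν) +
        ∫⁻ z in Metric.ball (0 : E) 1, ENNReal.ofReal (‖z‖ ^ (-μ)) ∂ν) := by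
  rw [← lintegral_mul_const _ hg.ennreal_ofReal]
  refine lintegral_mono fun x ↦ ?_
  gcongr
  refine (lintegral_mono fun y ↦ ofReal_div_norm_rpow_le hμ (hg1 y) (x - y)).trans ?_
  rw [lintegral_add_left hg.ennreal_ofReal, ← lintegral_indicator measurableSet_ball,
    lintegral_sub_left_eq_self]

/-- Error estimate R₂ in the proof of Lemma 3.4. -/
theorem error_estimate_R2 (n : ℕ) (hn : 3 ≤ n) (μ : ℝ) (hμ0 : 0 < μ) (hμn : μ < n)
    (ρ : ℝ) (hρ : 0 < ρ) :
    ∃ C : ℝ, 0 < C ∧ ∀ lam : ℝ, 1 ≤ lam → 1 ≤ lam * ρ →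
      ∫⁻ x in {x : EuclideanSpace ℝ (Fin n) | ρ / 2 < ‖x‖},
          ∫⁻ y in {y : EuclideanSpace ℝ (Fin n) | ρ / 2 < ‖y‖},
            ENNReal.ofReal
              (lam ^ ((2 * n - μ) / 2) * (1 + lam ^ 2 * ‖y‖ ^ 2) ^ (-((2 * n - μ) / 2)) *
                (lam ^ ((2 * n - μ) / 2) * (1 + lam ^ 2 * ‖x‖ ^ 2) ^ (-((2 * n - μ) / 2))) /
                ‖x - y‖ ^ μ) ≤
        ENNReal.ofReal (C * lam ^ (-(2 * n - μ))) := by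
  set a : ℝ := (2 * n - μ) / 2 with ha
  have ha0 : 0 ≤ a := by linarith
  have hfin : Module.finrank ℝ (EuclideanSpace ℝ (Fin n)) = n := finrank_euclideanSpace_fin
  set b : ℝ := (ρ ^ 2 / (4 + ρ ^ 2)) ^ (-a)
  have hb : 0 < b := by positivity
  set g : EuclideanSpace ℝ (Fin n) → ℝ := fun x ↦ (1 + ‖x‖ ^ 2) ^ (-a)
  have hg0 (x) : 0 ≤ g x := by positivity
  have hg1 (x) : g x ≤ 1 :=
    Real.rpow_le_one_of_one_le_of_nonpos (by nlinarith [sq_nonneg ‖x‖]) (by linarith)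
  have hgm : Measurable g := by fun_prop
  have hgint : ∫⁻ x, ENNReal.ofReal (g x) < ⊤ := by
    have h := integrable_rpow_neg_one_add_norm_sq (E := EuclideanSpace ℝ (Fin n)) (r := 2 * a)
      (μ := volume) (by rw [hfin]; linarith)
    simp only [show -(2 * a) / 2 = -a by ring] at h
    exact h.lintegral_lt_top
  have hsing := lintegral_ball_norm_rpow_neg_lt_top
    (volume : Measure (EuclideanSpace ℝ (Fin n))) (by omega) (μ := μ) (by rwa [hfin]) 1
  set J : ENNReal := ∫⁻ x, ENNReal.ofReal (g x) *
    ∫⁻ y, ENNReal.ofReal (g y / ‖x - y‖ ^ μ) with hJ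
  have hJtop : J ≠ ⊤ := ((lintegral_lintegral_riesz_le volume hμ0.le hgm hg1).trans_lt
    (ENNReal.mul_lt_top hgint (ENNReal.add_lt_top.2 ⟨hgint, hsing⟩))).ne
  refine ⟨b ^ 2 * (J.toReal + 1), by positivity, fun lam hlam _ ↦ ?_⟩
  have hlam0 : 0 < lam := by linarith
  set D : ℝ := (b * lam ^ (-a)) ^ 2 with hD
  have hD0 : 0 ≤ D := by positivity
  have hDeq : D = b ^ 2 * lam ^ (-(2 * n - μ)) := by
    rw [hD, mul_pow, ← Real.rpow_natCast (lam ^ (-a)), ← Real.rpow_mul hlam0.le]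
    congr 2
    push_cast
    linarith
  have hpt (x y : EuclideanSpace ℝ (Fin n)) (hx : ρ / 2 < ‖x‖) (hy : ρ / 2 < ‖y‖) :
      ENNReal.ofReal (lam ^ a * (1 + lam ^ 2 * ‖y‖ ^ 2) ^ (-a) *
        (lam ^ a * (1 + lam ^ 2 * ‖x‖ ^ 2) ^ (-a)) / ‖x - y‖ ^ μ) ≤
      ENNReal.ofReal D * ENNReal.ofReal (g x) * ENNReal.ofReal (g y / ‖x - y‖ ^ μ) := by
    rw [← ENNReal.ofReal_mul hD0, ← ENNReal.ofReal_mul (mul_nonneg hD0 (hg0 x))]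
    refine ENNReal.ofReal_le_ofReal ?_
    rw [← mul_div_assoc]
    gcongr ?_ / _
    calc _ ≤ (b * lam ^ (-a) * g y) * (b * lam ^ (-a) * g x) :=
          mul_le_mul (rpow_mul_one_add_sq_rpow_neg_le hρ hlam0 ha0 hy)
            (rpow_mul_one_add_sq_rpow_neg_le hρ hlam0 ha0 hx) (by positivity) (by positivity)
      _ = _ := by
          rw [hD]
          ring
  have hmeas : MeasurableSet {x : EuclideanSpace ℝ (Fin n) | ρ / 2 < ‖x‖} :=
    measurableSet_lt measurable_const measurable_norm
  calc _ ≤ ∫⁻ x in {x : EuclideanSpace ℝ (Fin n) | ρ / 2 < ‖x‖},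
          ENNReal.ofReal D *
            (ENNReal.ofReal (g x) * ∫⁻ y, ENNReal.ofReal (g y / ‖x - y‖ ^ μ)) := by
        refine setLIntegral_mono' hmeas fun x hx ↦ ?_
        refine (setLIntegral_mono' hmeas fun y hy ↦ hpt x y hx hy).trans ?_
        rw [← mul_assoc, ← lintegral_const_mul' _ _
          (ENNReal.mul_ne_top ENNReal.ofReal_ne_top ENNReal.ofReal_ne_top)]
        exact setLIntegral_le_lintegral _ _
    _ ≤ ENNReal.ofReal D * J := by
        rw [hJ, ← lintegral_const_mul' _ _ ENNReal.ofReal_ne_top]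
        exact setLIntegral_le_lintegral _ _
    _ = ENNReal.ofReal (D * J.toReal) := by
        rw [ENNReal.ofReal_mul hD0, ENNReal.ofReal_toReal hJtop]
    _ ≤ _ := by
        refine ENNReal.ofReal_le_ofReal ?_
        rw [mul_right_comm, ← hDeq]
        exact mul_le_mul_of_nonneg_left (by linarith) hD0
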